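/- Let a < b, let p and J ≥ 1 be natural numbers, and let f : ℝ → ℝ be (p+1)-times continuously differentiable on [a,b]. Partition [a,b] into J subintervals I^j of equal length (b−a)/J. Then there exist polynomials q₁, …, q_J, each of degree at most p, such that (∑_{j=1}^J ‖f − q_j‖²_{L²(I^j)})^{1/2} ≤ ((b−a)/J)^{p+1} · ‖f^{(p+1)}‖_{L²(a,b)}. -/

import Mathlib

open MeasureTheory intervalIntegral

open Set in
/-- Cauchy–Schwarz against the constant function `1` on an interval. -/
lemma sq_intervalIntegral_le {c d : ℝ} (hcd : c ≤ d) {u : ℝ → ℝ} (hu : ContinuousOn u (Icc c d)) :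
    (∫ x in c..d, u x) ^ 2 ≤ (d - c) * ∫ x in c..d, u x ^ 2 := by
  rcases hcd.eq_or_lt with rfl | hlt
  · simp
  have hu' : ContinuousOn u (uIcc c d) := by rwa [uIcc_of_le hcd]
  set I := ∫ x in c..d, u x with hI
  have h1 : IntervalIntegrable u volume c d := hu'.intervalIntegrable
  have h2 : IntervalIntegrable (fun x => u x ^ 2) volume c d := (hu'.pow 2).intervalIntegrable
  have h0 : 0 ≤ ∫ x in c..d, ((d - c) * u x - I) ^ 2 :=
    integral_nonneg hcd fun x _ => sq_nonneg _
  have h3 : ∫ x in c..d, ((d - c) * u x - I) ^ 2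
      = (d - c) * ((d - c) * (∫ x in c..d, u x ^ 2) - I ^ 2) := by
    have : ∀ x, ((d - c) * u x - I) ^ 2
        = (d - c) ^ 2 * u x ^ 2 - 2 * (d - c) * I * u x + I ^ 2 := fun x => by ring
    simp_rw [this]
    rw [integral_add ((h2.const_mul _).sub (h1.const_mul _)) intervalIntegrable_const,
      integral_sub (h2.const_mul _) (h1.const_mul _), intervalIntegral.integral_const_mul,
      intervalIntegral.integral_const_mul, intervalIntegral.integral_const, ← hI, smul_eq_mul]
    ring
  rw [h3] at h0
  linarith [nonneg_of_mul_nonneg_right h0 (sub_pos.2 hlt)]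

open Set in
/-- The Poincaré inequality on an interval for a function vanishing at the left endpoint. -/
lemma integral_sq_le_of_left_eq_zero {c d : ℝ} (hcd : c ≤ d) {e e' : ℝ → ℝ} (h0 : e c = 0)
    (hd : ∀ x ∈ Icc c d, HasDerivWithinAt e (e' x) (Icc c d) x) (he' : ContinuousOn e' (Icc c d)) :
    ∫ x in c..d, e x ^ 2 ≤ (d - c) ^ 2 * ∫ x in c..d, e' x ^ 2 := by
  have he : ContinuousOn e (Icc c d) := fun x hx => (hd x hx).continuousWithinAt
  have hi : IntervalIntegrable (fun x => e' x ^ 2) volume c d :=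
    ContinuousOn.intervalIntegrable (by rw [uIcc_of_le hcd]; exact he'.pow 2)
  have hpt : ∀ x ∈ Icc c d, e x ^ 2 ≤ (d - c) * ∫ x in c..d, e' x ^ 2 := by
    intro x hx
    have hsub : Icc c x ⊆ Icc c d := Icc_subset_Icc_right hx.2
    have hftc : ∫ t in c..x, e' t = e x := by
      rw [integral_eq_sub_of_hasDerivAt_of_le hx.1 (he.mono hsub) (f' := e') _ _, h0, sub_zero]
      · exact fun t ht => (hd t (hsub (Ioo_subset_Icc_self ht))).hasDerivAt
          (Icc_mem_nhds ht.1 (ht.2.trans_le hx.2))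
      · exact ContinuousOn.intervalIntegrable (by rw [uIcc_of_le hx.1]; exact he'.mono hsub)
    calc e x ^ 2 ≤ (x - c) * ∫ t in c..x, e' t ^ 2 := by
          rw [← hftc]; exact sq_intervalIntegral_le hx.1 (he'.mono hsub)
      _ ≤ (d - c) * ∫ t in c..d, e' t ^ 2 := by
          refine mul_le_mul (by linarith [hx.2]) ?_
            (integral_nonneg hx.1 fun _ _ => sq_nonneg _) (sub_nonneg.2 hcd)
          exact integral_mono_interval le_rfl hx.1 hx.2
            (Filter.Eventually.of_forall fun _ => sq_nonneg _) hi
  calc ∫ x in c..d, e x ^ 2 ≤ ∫ _ in c..d, ((d - c) * ∫ x in c..d, e' x ^ 2) :=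
        integral_mono_on hcd
          (ContinuousOn.intervalIntegrable (by rw [uIcc_of_le hcd]; exact he.pow 2))
          intervalIntegrable_const hpt
    _ = (d - c) ^ 2 * ∫ x in c..d, e' x ^ 2 := by
        rw [intervalIntegral.integral_const, smul_eq_mul]; ring

namespace Polynomial

/-- Every polynomial has an antiderivative with a prescribed value at a point. -/
lemma exists_derivative_eq_and_eval_eq {K : Type*} [Field K] [CharZero K] (q : K[X]) (c y : K) :
    ∃ P : K[X], derivative P = q ∧ P.eval c = y := by
  obtain ⟨P, hP⟩ : ∃ P : K[X], derivative P = q := by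
    induction q using Polynomial.induction_on' with
    | add p q hp hq =>
      obtain ⟨P, rfl⟩ := hp
      obtain ⟨Q, rfl⟩ := hq
      exact ⟨P + Q, derivative_add⟩
    | monomial n a =>
      refine ⟨monomial (n + 1) (a / (n + 1)), ?_⟩
      have : (n + 1 : K) ≠ 0 := Nat.cast_add_one_ne_zero n
      rw [derivative_monomial]
      simp [this]
  exact ⟨P + C (y - P.eval c), by simp [hP], by simp⟩

lemma degree_lt_succ_of_degree_derivative_lt {K : Type*} [Field K] [CharZero K] {P : K[X]} {n : ℕ}
    (h : (derivative P).degree < n) : P.degree < (n + 1 : ℕ) := by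
  rw [degree_lt_iff_coeff_zero] at h ⊢
  rintro (_ | m) hm
  · omega
  · have := h m (by omega)
    rw [coeff_derivative] at this
    exact (mul_eq_zero.1 this).resolve_right (Nat.cast_add_one_ne_zero m)

end Polynomial

open Set in
/-- `L²` approximation on an interval by a polynomial of degree `< n`, for a function with
successive derivatives `g 0, …, g n`. -/
lemma exists_polynomial_integral_sq_sub_le {c d : ℝ} (hcd : c ≤ d) (n : ℕ) (g : ℕ → ℝ → ℝ)
    (hg : ∀ i < n, ∀ x ∈ Icc c d, HasDerivWithinAt (g i) (g (i + 1) x) (Icc c d) x)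
    (hc : ContinuousOn (g n) (Icc c d)) :
    ∃ q : Polynomial ℝ, q.degree < n ∧
      ∫ x in c..d, (g 0 x - q.eval x) ^ 2 ≤ (d - c) ^ (2 * n) * ∫ x in c..d, g n x ^ 2 := by
  induction n generalizing g with
  | zero => exact ⟨0, by simp, by simp⟩
  | succ n ih =>
    obtain ⟨q, hq, hle⟩ := ih (fun i => g (i + 1)) (fun i hi => hg (i + 1) (by omega)) hc
    obtain ⟨P, rfl, hPc⟩ := Polynomial.exists_derivative_eq_and_eval_eq q c (g 0 c)
    refine ⟨P, Polynomial.degree_lt_succ_of_degree_derivative_lt hq, ?_⟩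
    have hc1 : ContinuousOn (g 1) (Icc c d) := by
      rcases n with _ | n
      · exact hc
      · exact fun x hx => (hg 1 (by omega) x hx).continuousWithinAt
    have hpoin := integral_sq_le_of_left_eq_zero hcd (e := fun x => g 0 x - P.eval x)
      (e' := fun x => g 1 x - P.derivative.eval x) (by simp [hPc])
      (fun x hx => (hg 0 (by omega) x hx).sub (P.hasDerivAt x).hasDerivWithinAt)
      (hc1.sub P.derivative.continuous.continuousOn)
    calc _ ≤ _ := hpoin
      _ ≤ (d - c) ^ 2 * ((d - c) ^ (2 * n) * ∫ x in c..d, g (n + 1) x ^ 2) := by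
          gcongr
      _ = _ := by ring

/-- Piecewise polynomial approximation on J equal subintervals (bundles): the combined L² error
of order-p polynomial approximation decays like ((b-a)/J)^(p+1). -/
theorem equal_bundles_polynomial_L2_approximation (a b : ℝ) (hab : a < b) (p J : ℕ)
    (hJ : 1 ≤ J) (f : ℝ → ℝ) (hf : ContDiffOn ℝ (p + 1) f (Set.Icc a b)) :
    ∃ q : Fin J → Polynomial ℝ,
      (∀ j, (q j).natDegree ≤ p) ∧
      Real.sqrt (∑ j : Fin J,
          ∫ x in (a + (j : ℕ) * ((b - a) / (J : ℝ)))..(a + ((j : ℕ) + 1) * ((b - a) / (J : ℝ))),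
            (f x - (q j).eval x) ^ 2) ≤
        ((b - a) / (J : ℝ)) ^ (p + 1) *
          Real.sqrt (∫ x in a..b, (iteratedDerivWithin (p + 1) f (Set.Icc a b) x) ^ 2) := by
  set h := (b - a) / (J : ℝ) with hh
  have hJ0 : (0 : ℝ) < J := by exact_mod_cast hJ
  have hpos : 0 < h := div_pos (sub_pos.2 hab) hJ0
  have hJh : (J : ℝ) * h = b - a := mul_div_cancel₀ _ hJ0.ne'
  have hu : UniqueDiffOn ℝ (Set.Icc a b) := uniqueDiffOn_Icc hab
  have hcont : ContinuousOn (iteratedDerivWithin (p + 1) f (Set.Icc a b)) (Set.Icc a b) :=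
    hf.continuousOn_iteratedDerivWithin (by norm_cast) hu
  have hderiv : ∀ i < p + 1, ∀ x ∈ Set.Icc a b,
      HasDerivWithinAt (iteratedDerivWithin i f (Set.Icc a b))
        (iteratedDerivWithin (i + 1) f (Set.Icc a b) x) (Set.Icc a b) x := by
    intro i hi x hx
    rw [iteratedDerivWithin_succ]
    exact (hf.differentiableOn_iteratedDerivWithin (by exact_mod_cast hi) hu x hx).hasDerivWithinAt
  have hsub : ∀ j < J, Set.Icc (a + (j : ℕ) * h) (a + ((j : ℕ) + 1) * h) ⊆ Set.Icc a b := by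
    intro j hj
    have h1 : ((j : ℝ) + 1) ≤ J := by exact_mod_cast hj
    have h2 : ((j : ℝ) + 1) * h ≤ J * h := by gcongr
    exact Set.Icc_subset_Icc (le_add_of_nonneg_right (by positivity)) (by linarith)
  have hle : ∀ j : ℕ, a + (j : ℝ) * h ≤ a + ((j : ℝ) + 1) * h := fun j => by linarith
  have hloc : ∀ j : Fin J, ∃ q : Polynomial ℝ, q.degree < (p + 1 : ℕ) ∧
      ∫ x in (a + (j : ℕ) * h)..(a + ((j : ℕ) + 1) * h), (f x - q.eval x) ^ 2 ≤
        h ^ (2 * (p + 1)) * ∫ x in (a + (j : ℕ) * h)..(a + ((j : ℕ) + 1) * h),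
          (iteratedDerivWithin (p + 1) f (Set.Icc a b) x) ^ 2 := by
    intro j
    have hs := hsub j j.2
    have key := exists_polynomial_integral_sq_sub_le (hle j) (p + 1)
      (fun i => iteratedDerivWithin i f (Set.Icc a b))
      (fun i hi x hx => (hderiv i hi x (hs hx)).mono hs) (hcont.mono hs)
    have hlen : a + ((j : ℕ) + 1) * h - (a + (j : ℕ) * h) = h := by ring
    simpa only [hlen, iteratedDerivWithin_zero] using key
  choose q hq hqle using hloc
  refine ⟨q, fun j => Polynomial.natDegree_le_iff_degree_le.2
    (Order.le_of_lt_succ (by exact_mod_cast hq j)), ?_⟩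
  have hsum : ∑ j : Fin J, ∫ x in (a + (j : ℕ) * h)..(a + ((j : ℕ) + 1) * h),
      (iteratedDerivWithin (p + 1) f (Set.Icc a b) x) ^ 2 =
      ∫ x in a..b, (iteratedDerivWithin (p + 1) f (Set.Icc a b) x) ^ 2 := by
    rw [Fin.sum_univ_eq_sum_range (fun j : ℕ => ∫ x in (a + (j : ℝ) * h)..(a + ((j : ℝ) + 1) * h),
      (iteratedDerivWithin (p + 1) f (Set.Icc a b) x) ^ 2)]
    have := sum_integral_adjacent_intervals (μ := volume) (a := fun j : ℕ => a + (j : ℝ) * h)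
      (n := J) (f := fun x => (iteratedDerivWithin (p + 1) f (Set.Icc a b) x) ^ 2) ?_
    · simpa [hJh] using this
    · intro j hj
      refine ContinuousOn.intervalIntegrable ?_
      push_cast
      rw [Set.uIcc_of_le (hle j)]
      exact (hcont.mono (hsub j hj)).pow 2
  refine Real.sqrt_le_iff.2 ⟨by positivity, ?_⟩
  rw [mul_pow, Real.sq_sqrt (integral_nonneg hab.le fun _ _ => sq_nonneg _), ← hsum,
    Finset.mul_sum, ← pow_mul, mul_comm (p + 1) 2]
  exact Finset.sum_le_sum fun j _ => hqle j
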